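/- Let 0 < β < H < 1 and let B^H be a fractional Brownian motion with Hurst index H. Then there exist constants 0 < K₁ ≤ K₂ < ∞ depending on H and β such that for all 0 < ε < 1, -K₂ ε^{-1/(H-β)} ≤ log P(sup_{0≤s<t≤1} |B^H_t - B^H_s|/|t-s|^β ≤ ε) ≤ -K₁ ε^{-1/(H-β)}. -/

import Mathlib

open MeasureTheory ProbabilityTheory


namespace FbmSB

/-- all linear combinations are centered Gaussian -/
def GaussFam {Ω : Type*} {m0 : MeasurableSpace Ω} (P : Measure Ω) {I : Type*} [Fintype I]
    (D : I → Ω → ℝ) : Prop :=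
  ∀ c : I → ℝ, ∃ v : NNReal, P.map (fun ω => ∑ i, c i * D i ω) = gaussianReal 0 v

lemma integral_cexp_gauss {Ω : Type*} {m0 : MeasurableSpace Ω} (P : Measure Ω)
    (Z : Ω → ℝ) (hZ : Measurable Z) (v : NNReal) (h : P.map Z = gaussianReal 0 v) (t : ℝ) :
    ∫ ω, Complex.exp ((t * Z ω : ℝ) * Complex.I) ∂P = Complex.exp (-(v * t ^ 2 / 2)) := by
  have h1 := charFun_gaussianReal (μ := 0) (v := v) t
  rw [← h, charFun_apply_real, integral_map hZ.aemeasurable (by fun_prop)] at h1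
  rw [show (fun ω => Complex.exp ((t * Z ω : ℝ) * Complex.I)) =
    fun ω => Complex.exp (t * Z ω * Complex.I) by ext; push_cast; rfl, h1]
  congr 1
  simp

lemma double_law {Ω : Type*} {m0 : MeasurableSpace Ω} (P : Measure Ω)
    [IsProbabilityMeasure P] {I : Type*} [Fintype I] (D : I → Ω → ℝ)
    (hD : ∀ i, Measurable (D i)) (hG : GaussFam P D) :
    (P.prod P).map (fun p : Ω × Ω => fun i => D i p.1 - D i p.2) =
      P.map (fun ω i => √2 * D i ω) := by
  classical
  have m1 : Measurable (fun p : Ω × Ω => fun i => D i p.1 - D i p.2) := by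
    refine measurable_pi_lambda _ fun i => ?_
    exact ((hD i).comp measurable_fst).sub ((hD i).comp measurable_snd)
  have m2 : Measurable (fun ω i => √2 * D i ω) :=
    measurable_pi_lambda _ fun i => (hD i).const_mul _
  have := Measure.isProbabilityMeasure_map (μ := P.prod P) m1.aemeasurable
  have := Measure.isProbabilityMeasure_map (μ := P) m2.aemeasurable
  refine Measure.ext_of_charFunDual (funext fun L => ?_)
  rw [charFunDual_apply, charFunDual_apply, integral_map m1.aemeasurable (by fun_prop),
    integral_map m2.aemeasurable (by fun_prop)]
  set c : I → ℝ := fun i => L (Pi.single i 1) with hc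
  have hL : ∀ x : I → ℝ, L x = ∑ i, c i * x i := by
    intro x
    conv_lhs => rw [pi_eq_sum_univ' x]
    rw [map_sum]
    refine Finset.sum_congr rfl fun i _ => ?_
    rw [map_smul, smul_eq_mul, mul_comm, hc]
  obtain ⟨v, hv⟩ := hG c
  set Z : Ω → ℝ := fun ω => ∑ i, c i * D i ω with hZdef
  have hZ : Measurable Z := Finset.measurable_sum _ fun i _ => (hD i).const_mul _
  have e1 : ∀ p : Ω × Ω, Complex.exp ((L fun i => D i p.1 - D i p.2) * Complex.I) =
      Complex.exp ((1 * Z p.1 : ℝ) * Complex.I) * Complex.exp (((-1) * Z p.2 : ℝ) * Complex.I) := by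
    intro p
    rw [← Complex.exp_add, hL]
    congr 1
    rw [← add_mul]
    congr 1
    rw [← Complex.ofReal_add]
    congr 1
    simp only [hZdef, mul_sub, Finset.sum_sub_distrib]
    ring
  have e2 : ∀ ω, Complex.exp ((L fun i => √2 * D i ω) * Complex.I) =
      Complex.exp ((√2 * Z ω : ℝ) * Complex.I) := by
    intro ω
    rw [hL]
    congr 3
    simp only [hZdef, Finset.mul_sum]
    refine Finset.sum_congr rfl fun i _ => by ring
  simp_rw [e1, e2]
  rw [integral_prod_mul (fun ω => Complex.exp ((1 * Z ω : ℝ) * Complex.I))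
    (fun ω => Complex.exp (((-1) * Z ω : ℝ) * Complex.I)),
    integral_cexp_gauss P Z hZ v hv, integral_cexp_gauss P Z hZ v hv,
    integral_cexp_gauss P Z hZ v hv, ← Complex.exp_add]
  congr 1
  have : ((√2 : ℝ) : ℂ) ^ 2 = 2 := by norm_cast; simp
  rw [this]; push_cast; ring

lemma collision {Ω : Type*} {m0 : MeasurableSpace Ω} (P : Measure Ω)
    [IsProbabilityMeasure P] {K : Type*} [Countable K] [MeasurableSpace K]
    [MeasurableSingletonClass K] (Y : Ω → K) (hY : Measurable Y) (w : K → ℝ) (hw : ∀ y, 0 ≤ w y)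
    (hw1 : ∀ S : Finset K, ∑ y ∈ S, w y ≤ 1) :
    (∫ ω, √(w (Y ω)) ∂P) ^ 2 ≤ (P.prod P).real {p : Ω × Ω | Y p.1 = Y p.2} := by
  classical
  have hmK : ∀ f : K → ℝ, Measurable f := fun f => Measurable.of_discrete
  have hb : ∀ y, w y ≤ 1 := fun y => by simpa using hw1 {y}
  have hIntg : Integrable (fun y => √(w y)) (P.map Y) := by
    have := Measure.isProbabilityMeasure_map (μ := P) hY.aemeasurable
    refine Integrable.of_bound (C := 1) (hmK _).aestronglyMeasurable (ae_of_all _ fun y => ?_)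
    rw [Real.norm_of_nonneg (Real.sqrt_nonneg _)]
    exact Real.sqrt_le_one.2 (hb y)
  have h1 : ∫ ω, √(w (Y ω)) ∂P = ∑' y, P.real (Y ⁻¹' {y}) * √(w y) := by
    rw [← integral_map (f := fun y => √(w y)) hY.aemeasurable (hmK _).aestronglyMeasurable,
      integral_countable hIntg]
    refine tsum_congr fun y => ?_
    rw [smul_eq_mul, map_measureReal_apply hY (measurableSet_singleton _)]
  set q := (P.prod P).real {p : Ω × Ω | Y p.1 = Y p.2} with hq
  have hq0 : 0 ≤ q := measureReal_nonneg
  have h2 : ∀ S : Finset K, ∑ y ∈ S, P.real (Y ⁻¹' {y}) * √(w y) ≤ √q := by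
    intro S
    apply Real.le_sqrt_of_sq_le
    refine (Finset.sum_mul_sq_le_sq_mul_sq S _ _).trans ?_
    have a1 : ∑ y ∈ S, √(w y) ^ 2 ≤ 1 := by
      simpa [Real.sq_sqrt (hw _)] using hw1 S
    have a2 : ∑ y ∈ S, P.real (Y ⁻¹' {y}) ^ 2 ≤ q := by
      have : ∀ y ∈ S, P.real (Y ⁻¹' {y}) ^ 2 = (P.prod P).real ((Y ⁻¹' {y}) ×ˢ (Y ⁻¹' {y})) := by
        intro y _
        rw [measureReal_prod_prod, sq]
      rw [Finset.sum_congr rfl this, ← measureReal_biUnion_finset]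
      · refine measureReal_mono ?_
        intro p hp
        simp only [Set.mem_iUnion, Set.mem_prod, Set.mem_preimage, Set.mem_singleton_iff] at hp
        obtain ⟨y, _, h1, h2⟩ := hp
        simp [h1, h2]
      · intro a _ b _ hab
        refine Set.disjoint_left.2 fun p hp hp' => hab ?_
        simp only [Set.mem_prod, Set.mem_preimage, Set.mem_singleton_iff] at hp hp'
        rw [← hp.1, hp'.1]
      · intro y _
        exact (hY (measurableSet_singleton _)).prod (hY (measurableSet_singleton _))
    calc _ ≤ q * 1 := by
          apply mul_le_mul a2 a1 (Finset.sum_nonneg fun i _ => sq_nonneg _) hq0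
      _ = q := mul_one q
  have h3 : ∑' y, P.real (Y ⁻¹' {y}) * √(w y) ≤ √q :=
    Real.tsum_le_of_sum_le (fun y => by positivity) h2
  rw [h1]
  calc _ ≤ (√q) ^ 2 := by
        apply pow_le_pow_left₀ (tsum_nonneg fun y => by positivity) h3
    _ = q := Real.sq_sqrt hq0

end FbmSB


namespace FbmSB

/-- two-sided geometric weight -/
noncomputable def geo (z : ℝ) (y : ℤ) : ℝ := z / (2 + z) * (1 / (1 + z)) ^ y.natAbs

lemma geo_pos {z : ℝ} (hz : 0 < z) (y : ℤ) : 0 < geo z y := by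
  unfold geo; positivity

lemma geo_sum {z : ℝ} (hz : 0 < z) (T : Finset ℤ) : ∑ y ∈ T, geo z y ≤ 1 := by
  have hr0 : 0 ≤ 1 / (1 + z) := by positivity
  have hr1 : 1 / (1 + z) < 1 := by rw [div_lt_one (by positivity)]; linarith
  have h1 := (hasSum_geometric_of_lt_one hr0 hr1)
  have h := HasSum.of_nat_of_neg_add_one (f := fun y : ℤ => geo z y)
    (m := z / (2 + z) * (1 - 1 / (1 + z))⁻¹)
    (m' := z / (2 + z) * (1 / (1 + z)) * (1 - 1 / (1 + z))⁻¹) ?_ ?_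
  · refine (sum_le_hasSum T (fun y _ => (geo_pos hz y).le) h).trans (le_of_eq ?_)
    have : (1 - 1 / (1 + z)) = z / (1 + z) := by field_simp; ring
    rw [this]
    field_simp
    ring
  · exact h1.mul_left _
  · have := h1.mul_left (z / (2 + z) * (1 / (1 + z)))
    refine this.congr_fun ?_ |> id
    intro n
    simp only [geo]
    have : (-((n : ℤ) + 1)).natAbs = n + 1 := by omega
    rw [this, pow_succ]; ring

lemma sqrt_geo {z : ℝ} (hz : 0 < z) (y : ℤ) :
    geo z y = Real.exp (-(Real.log (1 + 2 / z) + |(y : ℝ)| * Real.log (1 + z))) := by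
  rw [neg_add, Real.exp_add, geo]
  congr 1
  · rw [Real.exp_neg, Real.exp_log (by positivity)]
    field_simp; ring
  · rw [← mul_neg, ← Real.log_inv, mul_comm, Real.exp_mul, Real.exp_log (by positivity), one_div]
    rw [← Int.cast_abs, Int.abs_eq_natAbs, Int.cast_natCast, Real.rpow_natCast]

lemma pi_sum {I : Type*} [Fintype I] (f : I → ℤ → ℝ) (hf : ∀ i y, 0 ≤ f i y)
    (h1 : ∀ i (T : Finset ℤ), ∑ y ∈ T, f i y ≤ 1) (S : Finset (I → ℤ)) :
    ∑ y ∈ S, ∏ i, f i (y i) ≤ 1 := by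
  classical
  have hS : S ⊆ Fintype.piFinset (fun i => S.image (fun y => y i)) := by
    intro y hy
    rw [Fintype.mem_piFinset]
    intro i
    exact Finset.mem_image_of_mem _ hy
  refine (Finset.sum_le_sum_of_subset_of_nonneg hS
    (fun y _ _ => Finset.prod_nonneg fun i _ => hf i _)).trans ?_
  rw [← Finset.prod_univ_sum]
  exact Finset.prod_le_one (fun i _ => Finset.sum_nonneg fun y _ => hf i y) fun i _ => h1 i _

lemma abs_round_le (x m : ℝ) (hm : 1 ≤ m) : |(round x : ℝ)| ≤ |2 * x| ^ m := by
  by_cases h : round x = 0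
  · rw [h]; simp; positivity
  · have h1 : (1 : ℝ) ≤ |(round x : ℝ)| := by
      rw [← Int.cast_abs]; exact_mod_cast Int.one_le_abs h
    have h2 := abs_sub_round x
    have h3 : |(round x : ℝ)| ≤ |2 * x| := by
      rw [abs_mul, abs_two]
      have := abs_sub_abs_le_abs_sub (round x : ℝ) x
      rw [abs_sub_comm] at this
      linarith
    refine h3.trans (Real.self_le_rpow_of_one_le (h1.trans h3) hm)

lemma small_ball {Ω : Type*} {m0 : MeasurableSpace Ω} (P : Measure Ω)
    [IsProbabilityMeasure P] {I : Type*} [Fintype I] (D : I → Ω → ℝ)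
    (hD : ∀ i, Measurable (D i)) (hG : GaussFam P D) (a z : I → ℝ) (ha : ∀ i, 0 < a i)
    (hz : ∀ i, 0 < z i) (C m : ℝ) (hm : 1 ≤ m)
    (hIntg : ∀ i, Integrable (fun ω => |2 * (D i ω / (√2 * a i))| ^ m) P)
    (hmom : ∀ i, ∫ ω, |2 * (D i ω / (√2 * a i))| ^ m ∂P ≤ C / z i) :
    Real.exp (-∑ i, (Real.log (1 + 2 / z i) + C / z i * Real.log (1 + z i))) ≤
      P.real {ω | ∀ i, |D i ω| ≤ a i} := by
  classical
  set Y : Ω → I → ℤ := fun ω i => round (D i ω / (√2 * a i)) with hYdef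
  have hY : Measurable Y := measurable_pi_lambda _ fun i => by
    have : Measurable (round : ℝ → ℤ) := by
      have : (round : ℝ → ℤ) = fun x => ⌊x + 1 / 2⌋ := by ext x; exact round_eq x
      rw [this]; fun_prop
    exact this.comp ((hD i).div_const _)
  set w : (I → ℤ) → ℝ := fun y => ∏ i, geo (z i) (y i) with hw
  have hc := collision P Y hY w (fun y => Finset.prod_nonneg fun i _ => (geo_pos (hz i) _).le)
    (pi_sum (fun i => geo (z i)) (fun i y => (geo_pos (hz i) y).le) (fun i T => geo_sum (hz i) T))
  -- comparison of events
  have hev : (P.prod P).real {p : Ω × Ω | Y p.1 = Y p.2} ≤ P.real {ω | ∀ i, |D i ω| ≤ a i} := by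
    have mS : MeasurableSet {x : I → ℝ | ∀ i, |x i| ≤ √2 * a i} := by
      rw [Set.ofPred_forall]
      refine MeasurableSet.iInter fun i => ?_
      exact measurableSet_le (by fun_prop) measurable_const
    have m1 : Measurable (fun p : Ω × Ω => fun i => D i p.1 - D i p.2) := by
      refine measurable_pi_lambda _ fun i => ?_
      exact ((hD i).comp measurable_fst).sub ((hD i).comp measurable_snd)
    have m2 : Measurable (fun ω i => √2 * D i ω) :=
      measurable_pi_lambda _ fun i => (hD i).const_mul _
    have h1 := congrArg (fun μ : Measure (I → ℝ) => μ.real {x : I → ℝ | ∀ i, |x i| ≤ √2 * a i})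
      (double_law P D hD hG)
    rw [map_measureReal_apply m1 mS, map_measureReal_apply m2 mS] at h1
    have h2 : ((fun ω i => √2 * D i ω) ⁻¹' {x : I → ℝ | ∀ i, |x i| ≤ √2 * a i}) =
        {ω | ∀ i, |D i ω| ≤ a i} := by
      ext ω
      simp only [Set.mem_preimage, Set.mem_ofPred_eq]
      refine forall_congr' fun i => ?_
      rw [abs_mul, abs_of_nonneg (Real.sqrt_nonneg 2), mul_le_mul_iff_right₀ (by positivity)]
    rw [← h2, ← h1]
    refine measureReal_mono ?_
    intro p hp i
    have hp' : Y p.1 i = Y p.2 i := congrFun hp i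
    simp only [hYdef] at hp'
    have hb : 0 < √2 * a i := mul_pos (by positivity) (ha i)
    have r1 := abs_sub_round (D i p.1 / (√2 * a i))
    have r2 := abs_sub_round (D i p.2 / (√2 * a i))
    rw [hp'] at r1
    have : |D i p.1 / (√2 * a i) - D i p.2 / (√2 * a i)| ≤ 1 := by
      rw [abs_le] at *
      constructor <;> linarith [r1.1, r1.2, r2.1, r2.2]
    rw [← sub_div, abs_div, abs_of_pos hb, div_le_one hb] at this
    exact this
  refine le_trans ?_ (hc.trans hev)
  set μ := ∑ i, (Real.log (1 + 2 / z i) + C / z i * Real.log (1 + z i)) with hμ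
  set S : Ω → ℝ := fun ω => ∑ i, (Real.log (1 + 2 / z i) + |(Y ω i : ℝ)| * Real.log (1 + z i))
    with hS
  have hsq : ∀ ω, √(w (Y ω)) = Real.exp (-(S ω) / 2) := by
    intro ω
    have : w (Y ω) = Real.exp (-(S ω)) := by
      simp only [hw, hS]
      rw [← Finset.sum_neg_distrib, Real.exp_sum]
      exact Finset.prod_congr rfl fun i _ => sqrt_geo (hz i) _
    rw [this, Real.sqrt_eq_rpow, ← Real.exp_mul]
    congr 1; ring
  have iY : ∀ i, Integrable (fun ω => |(Y ω i : ℝ)|) P := by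
    intro i
    refine (hIntg i).mono' ?_ (ae_of_all _ fun ω => ?_)
    · have : Measurable (fun ω => Y ω i) := (measurable_pi_apply i).comp hY
      have h2 : Measurable (fun ω => ((Y ω i : ℤ) : ℝ)) := (Measurable.of_discrete (f := fun n : ℤ => (n : ℝ))).comp this
      exact h2.abs.aestronglyMeasurable
    · rw [Real.norm_of_nonneg (abs_nonneg _)]
      exact abs_round_le _ _ hm
  have iT : ∀ i ∈ Finset.univ, Integrable
      (fun ω => Real.log (1 + 2 / z i) + |(Y ω i : ℝ)| * Real.log (1 + z i)) P :=
    fun i _ => (integrable_const _).add ((iY i).mul_const _)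
  have iS : Integrable S P := integrable_finsetSum _ iT
  have hES : ∫ ω, S ω ∂P ≤ μ := by
    simp only [hS]
    rw [integral_finsetSum _ iT, hμ]
    refine Finset.sum_le_sum fun i _ => ?_
    rw [integral_add (integrable_const _) ((iY i).mul_const _), integral_mul_const]
    simp only [integral_const, probReal_univ, one_smul]
    gcongr
    · exact Real.log_nonneg (by linarith [hz i])
    · exact (integral_mono (iY i) (hIntg i) (fun ω => abs_round_le _ _ hm)).trans (hmom i)
  have key : Real.exp (-μ / 2) ≤ ∫ ω, √(w (Y ω)) ∂P := by
    have lb : ∀ ω, Real.exp (-μ / 2) * (1 + μ / 2 - S ω / 2) ≤ √(w (Y ω)) := by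
      intro ω
      rw [hsq]
      have : -(S ω) / 2 = -μ / 2 + (μ / 2 - S ω / 2) := by ring
      rw [this, Real.exp_add]
      gcongr
      linarith [Real.add_one_le_exp (μ / 2 - S ω / 2)]
    have i1 : Integrable (fun ω => Real.exp (-μ / 2) * (1 + μ / 2 - S ω / 2)) P :=
      ((integrable_const _).sub (iS.div_const _)).const_mul _
    have i2 : Integrable (fun ω => √(w (Y ω))) P := by
      refine Integrable.of_bound (C := 1) ?_ (ae_of_all _ fun ω => ?_)
      · exact ((Measurable.of_discrete (f := fun y => √(w y))).comp hY).aestronglyMeasurable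
      · rw [Real.norm_of_nonneg (Real.sqrt_nonneg _), Real.sqrt_le_one]
        have := pi_sum (fun i => geo (z i)) (fun i y => (geo_pos (hz i) y).le) (fun i T => geo_sum (hz i) T) {Y ω}
        simpa using this
    have := integral_mono i1 i2 lb
    refine le_trans ?_ this
    rw [integral_const_mul, integral_sub (integrable_const _) (iS.div_const _), integral_div]
    simp only [integral_const, probReal_univ, one_smul]
    nlinarith [Real.exp_pos (-μ / 2)]
  calc Real.exp (-μ) = Real.exp (-μ / 2) ^ 2 := by
        rw [← Real.exp_nat_mul]; congr 1; push_cast; ring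
    _ ≤ _ := pow_le_pow_left₀ (Real.exp_pos _).le key 2

end FbmSB


namespace FbmSB

lemma chain (x : ℝ → ℝ) (hx : Continuous x) (A r : ℝ) (hA : 0 ≤ A) (hr0 : 0 < r) (hr1 : r < 1)
    (h : ∀ j k : ℕ, k < 2 ^ j → |x (((k : ℝ) + 1) / 2 ^ j) - x ((k : ℝ) / 2 ^ j)| ≤ A * r ^ j)
    (s t : ℝ) (hs : s ∈ Set.Icc (0:ℝ) 1) (ht : t ∈ Set.Icc (0:ℝ) 1) (hst : s < t) :
    ∃ n : ℕ, (1/2 : ℝ) ^ (n + 1) < t - s ∧ |x t - x s| ≤ A * (1 + 2 / (1 - r)) * r ^ n := by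
  have pt : ∀ u ∈ Set.Icc (0:ℝ) 1, ∀ n : ℕ,
      |x ((⌊2 ^ n * u⌋₊ : ℝ) / 2 ^ n) - x u| ≤ A * r ^ n / (1 - r) := by
    intro u hu n
    have h1 : ∀ n : ℕ, dist (x ((⌊2 ^ n * u⌋₊ : ℝ) / 2 ^ n)) (x ((⌊2 ^ (n+1) * u⌋₊ : ℝ) / 2 ^ (n+1)))
        ≤ A * r ^ n := by
      intro n
      set a := ⌊2 ^ n * u⌋₊ with ha
      set b := ⌊2 ^ (n+1) * u⌋₊ with hb
      have hu0 : 0 ≤ u := hu.1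
      have a1 : (a : ℝ) ≤ 2 ^ n * u := Nat.floor_le (by positivity)
      have a2 : 2 ^ n * u < a + 1 := Nat.lt_floor_add_one _
      have b1 : (b : ℝ) ≤ 2 ^ (n+1) * u := Nat.floor_le (by positivity)
      have b2 : 2 ^ (n+1) * u < b + 1 := Nat.lt_floor_add_one _
      rw [pow_succ] at b1 b2
      have c1 : 2 * a < b + 1 := by
        have : (2 * a : ℝ) < b + 1 := by linarith
        exact_mod_cast this
      have c2 : b < 2 * a + 2 := by
        have : (b : ℝ) < 2 * a + 2 := by linarith
        exact_mod_cast this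
      have e0 : (a : ℝ) / 2 ^ n = (2 * a : ℝ) / 2 ^ (n+1) := by
        rw [pow_succ]; field_simp
      have hrr : A * r ^ (n+1) ≤ A * r ^ n :=
        mul_le_mul_of_nonneg_left (pow_le_pow_of_le_one hr0.le hr1.le (Nat.le_succ n)) hA
      rcases (by omega : b = 2 * a ∨ b = 2 * a + 1) with hb' | hb'
      · rw [hb', e0]
        push_cast
        rw [dist_self]; positivity
      · rw [e0, hb', dist_comm, Real.dist_eq]
        refine le_trans ?_ hrr
        have h3 : 2 * a < 2 ^ (n+1) := by
          have : (b : ℝ) ≤ 2 ^ (n+1) := by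
            rw [pow_succ]
            refine b1.trans ?_
            nlinarith [hu.2, show (0:ℝ) < 2 ^ n by positivity]
          have : b ≤ 2 ^ (n+1) := by exact_mod_cast this
          omega
        have := h (n+1) (2 * a) h3
        push_cast at this ⊢
        exact this
    have h2 : Filter.Tendsto (fun n : ℕ => x ((⌊2 ^ n * u⌋₊ : ℝ) / 2 ^ n)) Filter.atTop (nhds (x u)) := by
      refine (hx.tendsto u).comp ?_
      have := (tendsto_nat_floor_mul_div_atTop (R := ℝ) hu.1).comp
        (tendsto_pow_atTop_atTop_of_one_lt (one_lt_two : (1:ℝ) < 2))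
      refine this.congr fun n => ?_
      simp only [Function.comp]
      rw [mul_comm]
    have := dist_le_of_le_geometric_of_tendsto r A hr1 h1 h2 n
    rwa [Real.dist_eq] at this
  obtain ⟨n, hn1, hn2⟩ := exists_nat_pow_near_of_lt_one (x := t - s) (y := 1/2) (by linarith)
    (by linarith [hs.1, ht.2]) (by norm_num) (by norm_num)
  refine ⟨n, hn1, ?_⟩
  have p1 := pt s hs n
  have p2 := pt t ht n
  have mid : |x ((⌊2 ^ n * t⌋₊ : ℝ) / 2 ^ n) - x ((⌊2 ^ n * s⌋₊ : ℝ) / 2 ^ n)| ≤ A * r ^ n := by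
    set a := ⌊2 ^ n * s⌋₊ with ha
    set b := ⌊2 ^ n * t⌋₊ with hb
    have hs0 := hs.1
    have ht0 := ht.1
    have h2n : (0:ℝ) < 2 ^ n := by positivity
    have a1 : (a : ℝ) ≤ 2 ^ n * s := Nat.floor_le (by positivity)
    have a2 : 2 ^ n * s < a + 1 := Nat.lt_floor_add_one _
    have b1 : (b : ℝ) ≤ 2 ^ n * t := Nat.floor_le (by positivity)
    have b2 : 2 ^ n * t < b + 1 := Nat.lt_floor_add_one _
    have hd : 2 ^ n * t - 2 ^ n * s ≤ 1 := by
      rw [← mul_sub]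
      calc (2:ℝ) ^ n * (t - s) ≤ 2 ^ n * (1/2) ^ n := by gcongr
        _ = 1 := by rw [← mul_pow]; norm_num
    have hd' : 2 ^ n * s < 2 ^ n * t := by gcongr
    have c1 : a < b + 1 := by
      have : (a : ℝ) < b + 1 := by linarith
      exact_mod_cast this
    have c2 : b < a + 2 := by
      have : (b : ℝ) < a + 2 := by linarith
      exact_mod_cast this
    rcases (by omega : b = a ∨ b = a + 1) with hb' | hb'
    · rw [hb']; simp; positivity
    · have h3 : a < 2 ^ n := by
        have : (b : ℝ) ≤ 2 ^ n := by
          refine b1.trans ?_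
          nlinarith [ht.2]
        have : b ≤ 2 ^ n := by exact_mod_cast this
        omega
      have := h n a h3
      rw [hb']
      push_cast
      exact this
  have e : A * (1 + 2 / (1 - r)) * r ^ n = A * r ^ n + A * r ^ n / (1 - r) + A * r ^ n / (1 - r) := by
    ring
  rw [e]
  rw [abs_le] at *
  constructor <;> linarith [p1.1, p1.2, p2.1, p2.2, mid.1, mid.2]

section process

variable {Ω : Type*} {m0 : MeasurableSpace Ω} {P : Measure Ω} [IsProbabilityMeasure P]
    {H : ℝ} {X : ℝ → Ω → ℝ}

lemma comb_gauss 
    (hgauss : ∀ (n : ℕ) (c : Fin n → ℝ) (t : Fin n → ℝ),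
      ∃ v : NNReal, P.map (fun ω => ∑ i, c i * X (t i) ω) = gaussianReal 0 v)
    {J : Type*} [Fintype J] (c t : J → ℝ) :
    ∃ v : NNReal, P.map (fun ω => ∑ i, c i * X (t i) ω) = gaussianReal 0 v := by
  obtain ⟨v, hv⟩ := hgauss (Fintype.card J) (c ∘ (Fintype.equivFin J).symm)
    (t ∘ (Fintype.equivFin J).symm)
  refine ⟨v, ?_⟩
  rw [← hv]
  congr 1
  ext ω
  exact (Equiv.sum_comp (Fintype.equivFin J).symm (fun i => c i * X (t i) ω)).symm

lemma memLp_X (hmeas : ∀ t, Measurable (X t))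
    (hgauss : ∀ (n : ℕ) (c : Fin n → ℝ) (t : Fin n → ℝ),
      ∃ v : NNReal, P.map (fun ω => ∑ i, c i * X (t i) ω) = gaussianReal 0 v) (t : ℝ) :
    MemLp (X t) 2 P := by
  obtain ⟨v, hv⟩ := hgauss 1 (fun _ => 1) (fun _ => t)
  simp only [Finset.univ_unique, Finset.sum_const, Finset.card_singleton, one_mul, one_smul] at hv
  have := memLp_id_gaussianReal (μ := 0) (v := v) 2
  change MemLp id 2 _ at this
  rw [← hv, memLp_map_measure_iff (by fun_prop) (hmeas t).aemeasurable] at this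
  exact this

lemma comb_var (hmeas : ∀ t, Measurable (X t))
    (hgauss : ∀ (n : ℕ) (c : Fin n → ℝ) (t : Fin n → ℝ),
      ∃ v : NNReal, P.map (fun ω => ∑ i, c i * X (t i) ω) = gaussianReal 0 v)
    (hcov : ∀ s t : ℝ, ∫ ω, X s ω * X t ω ∂P =
      (1/2) * (|s| ^ (2*H) + |t| ^ (2*H) - |t - s| ^ (2*H)))
    {J : Type*} [Fintype J] (c t : J → ℝ) (v : NNReal)
    (hv : P.map (fun ω => ∑ i, c i * X (t i) ω) = gaussianReal 0 v) :
    (v : ℝ) = ∑ i, ∑ j, c i * c j *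
      ((1/2) * (|t i| ^ (2*H) + |t j| ^ (2*H) - |t j - t i| ^ (2*H))) := by
  have hm : Measurable (fun ω => ∑ i, c i * X (t i) ω) :=
    Finset.measurable_sum _ fun i _ => (hmeas _).const_mul _
  have h1 : (v : ℝ) = ∫ ω, (∑ i, c i * X (t i) ω) ^ 2 ∂P := by
    have h2 := variance_fun_id_gaussianReal (μ := 0) (v := v)
    rw [variance_eq_integral (by fun_prop), integral_id_gaussianReal, ← hv,
      integral_map hm.aemeasurable (by fun_prop)] at h2
    rw [← h2]
    simp
  rw [h1]
  have hi : ∀ i j, Integrable (fun ω => c i * c j * (X (t i) ω * X (t j) ω)) P := fun i j =>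
    ((memLp_X hmeas hgauss (t i)).integrable_mul (memLp_X hmeas hgauss (t j))).const_mul _
  have h3 : ∀ ω, (∑ i, c i * X (t i) ω) ^ 2 = ∑ i, ∑ j, c i * c j * (X (t i) ω * X (t j) ω) := by
    intro ω
    rw [sq, Finset.sum_mul_sum]
    refine Finset.sum_congr rfl fun i _ => Finset.sum_congr rfl fun j _ => by ring
  simp_rw [h3]
  rw [integral_finsetSum _ fun i _ => integrable_finsetSum _ fun j _ => hi i j]
  refine Finset.sum_congr rfl fun i _ => ?_
  rw [integral_finsetSum _ fun j _ => hi i j]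
  refine Finset.sum_congr rfl fun j _ => ?_
  rw [integral_const_mul, hcov]

lemma fam_gauss 
    (hgauss : ∀ (n : ℕ) (c : Fin n → ℝ) (t : Fin n → ℝ),
      ∃ v : NNReal, P.map (fun ω => ∑ i, c i * X (t i) ω) = gaussianReal 0 v)
    {I J : Type*} [Fintype I] [Fintype J] (d : J → ℝ) (t : I → J → ℝ) (D : I → Ω → ℝ)
    (hD : ∀ i ω, D i ω = ∑ a, d a * X (t i a) ω) : GaussFam P D := by
  intro c
  obtain ⟨v, hv⟩ := comb_gauss hgauss (J := I × J) (fun p => c p.1 * d p.2) (fun p => t p.1 p.2)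
  refine ⟨v, ?_⟩
  rw [← hv]
  congr 1
  ext ω
  rw [Fintype.sum_prod_type]
  refine Finset.sum_congr rfl fun i _ => ?_
  rw [hD, Finset.mul_sum]
  refine Finset.sum_congr rfl fun j _ => by ring

lemma incr_law (hmeas : ∀ t, Measurable (X t))
    (hgauss : ∀ (n : ℕ) (c : Fin n → ℝ) (t : Fin n → ℝ),
      ∃ v : NNReal, P.map (fun ω => ∑ i, c i * X (t i) ω) = gaussianReal 0 v)
    (hcov : ∀ s t : ℝ, ∫ ω, X s ω * X t ω ∂P =
      (1/2) * (|s| ^ (2*H) + |t| ^ (2*H) - |t - s| ^ (2*H))) (hH : 0 < H) (s t : ℝ) :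
    P.map (fun ω => X t ω - X s ω) = gaussianReal 0 (|t - s| ^ (2*H)).toNNReal := by
  obtain ⟨v, hv⟩ := hgauss 2 ![1, -1] ![t, s]
  have h := comb_var hmeas hgauss hcov _ _ v hv
  have e : (fun ω => X t ω - X s ω) = (fun ω => ∑ i, ![(1:ℝ), -1] i * X (![t, s] i) ω) := by
    ext ω; simp [Fin.sum_univ_two]; ring
  rw [e, hv]
  congr 1
  rw [← NNReal.coe_inj, h, Real.coe_toNNReal _ (by positivity)]
  have h0 : (0:ℝ) ^ (2 * H) = 0 := Real.zero_rpow (by positivity)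
  simp [Fin.sum_univ_two, h0, abs_sub_comm s t]
  ring

end process

lemma gauss_moment {Ω : Type*} {m0 : MeasurableSpace Ω} (P : Measure Ω)
    (Z : Ω → ℝ) (hZ : Measurable Z) (σ : ℝ) (hσ : 0 ≤ σ) (h : P.map Z = gaussianReal 0 (σ ^ 2).toNNReal)
    (m : ℝ) (hm : 1 ≤ m) (b : ℝ) :
    Integrable (fun ω => |b * Z ω| ^ m) P ∧
    ∫ ω, |b * Z ω| ^ m ∂P = (|b| * σ) ^ m * ∫ x, |x| ^ m ∂(gaussianReal 0 1) := by
  have hIntg : Integrable (fun x : ℝ => |x| ^ m) (gaussianReal 0 1) := by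
    have := (memLp_id_gaussianReal (μ := 0) (v := 1) m.toNNReal).integrable_norm_rpow'
    have h2 : ((m.toNNReal : ENNReal)).toReal = m := by
      simp; linarith
    rw [h2] at this
    simpa using this
  have hmap : (gaussianReal 0 1).map (fun x => σ * x) = P.map Z := by
    rw [h, gaussianReal_map_const_mul]
    congr 1
    · simp
    · rw [mul_one, Real.toNNReal_of_nonneg (sq_nonneg σ)]
  have e : ∀ x : ℝ, |b * (σ * x)| ^ m = (|b| * σ) ^ m * |x| ^ m := by
    intro x
    rw [← Real.mul_rpow (by positivity) (by positivity), ← mul_assoc, abs_mul, abs_mul, abs_of_nonneg hσ]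
  have ms : Measurable (fun x : ℝ => |b * x| ^ m) := by fun_prop
  constructor
  · have : Integrable (fun x : ℝ => |b * x| ^ m) (P.map Z) := by
      rw [← hmap, integrable_map_measure ms.aestronglyMeasurable (by fun_prop)]
      refine (hIntg.const_mul ((|b| * σ) ^ m)).congr (ae_of_all _ fun x => ?_)
      exact (e x).symm
    rwa [integrable_map_measure ms.aestronglyMeasurable hZ.aemeasurable] at this
  · have : ∫ x, |b * x| ^ m ∂(P.map Z) = ∫ ω, |b * Z ω| ^ m ∂P :=
      integral_map hZ.aemeasurable ms.aestronglyMeasurable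
    rw [← this, ← hmap, integral_map (by fun_prop) ms.aestronglyMeasurable, ← integral_const_mul]
    simp_rw [e]

end FbmSB


namespace FbmSB

lemma log_le_rpow {t s : ℝ} (ht : 0 ≤ t) (hs : 0 < s) (hs1 : s ≤ 1) :
    Real.log (1 + t) ≤ t ^ s / s := by
  have h1 : (1 + t) ^ s ≤ 1 + t ^ s := by
    simpa using Real.rpow_add_le_add_rpow (zero_le_one) ht hs.le hs1
  have h2 : s * Real.log (1 + t) ≤ t ^ s := by
    rw [← Real.log_rpow (by positivity)]
    refine (Real.log_le_log (by positivity) h1).trans ?_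
    have := Real.log_le_sub_one_of_pos (show 0 < 1 + t ^ s by positivity)
    linarith
  rw [le_div_iff₀ hs]; linarith

/-- cost function in terms of `p = 1 / z` -/
lemma cost_bound {p C s : ℝ} (hp : 0 < p) (hC : 0 ≤ C) (hs : 1/6 ≤ s) (hs1 : s ≤ 2/3) :
    Real.log (1 + 2 / p⁻¹) + C / p⁻¹ * Real.log (1 + p⁻¹) ≤ (12 + 3 * C) * p ^ s := by
  have h1 : Real.log (1 + 2 / p⁻¹) ≤ 12 * p ^ s := by
    have : 2 / p⁻¹ = 2 * p := by field_simp
    rw [this]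
    refine (log_le_rpow (by positivity) (s := s) (by linarith) (by linarith)).trans ?_
    rw [Real.mul_rpow (by norm_num) hp.le, div_le_iff₀ (by linarith)]
    have h2 : (2:ℝ) ^ s ≤ 2 := by
      simpa using Real.rpow_le_rpow_of_exponent_le (one_le_two) (show s ≤ 1 by linarith)
    have hps : 0 < p ^ s := by positivity
    nlinarith
  have h2 : C / p⁻¹ * Real.log (1 + p⁻¹) ≤ 3 * C * p ^ s := by
    have h3 := log_le_rpow (t := p⁻¹) (by positivity) (s := 1 - s) (by linarith) (by linarith)
    have h4 : (p⁻¹) ^ (1 - s) / (1 - s) ≤ 3 * (p⁻¹) ^ (1 - s) := by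
      rw [div_le_iff₀ (by linarith)]
      have : 0 < (p⁻¹) ^ (1 - s) := by positivity
      nlinarith
    have h5 : p * (p⁻¹) ^ (1 - s) = p ^ s := by
      rw [Real.inv_rpow hp.le, ← Real.rpow_neg hp.le]
      nth_rw 1 [← Real.rpow_one p]
      rw [← Real.rpow_add hp]; congr 1; ring
    have : C / p⁻¹ = C * p := by field_simp
    rw [this]
    calc C * p * Real.log (1 + p⁻¹) ≤ C * p * (3 * (p⁻¹) ^ (1 - s)) := by
          gcongr; exact h3.trans h4
      _ = 3 * C * (p * (p⁻¹) ^ (1 - s)) := by ring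
      _ = _ := by rw [h5]
  linarith

lemma sum_bound (f : ℕ → ℝ) (u B : ℝ) (hu : 1 ≤ u) (hB : 0 ≤ B)
    (h1 : ∀ j, f j ≤ B * (√u / √2 ^ j)) (h2 : ∀ j, f j ≤ B * (u / 2 ^ j) ^ 2) (N : ℕ) 
    (hf : ∀ j, 0 ≤ f j) :
    ∑ j ∈ Finset.range N, 2 ^ j * f j ≤ 8 * B * u := by
  obtain ⟨J, hJ1, hJ2⟩ := exists_nat_pow_near hu (one_lt_two : (1:ℝ) < 2)
  have q2 : √2 * √2 = 2 := Real.mul_self_sqrt (by norm_num)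
  have q14 : 1.4 ≤ √2 := Real.le_sqrt_of_sq_le (by norm_num)
  have pw : ∀ j : ℕ, (2:ℝ) ^ j = √2 ^ j * √2 ^ j := fun j => by rw [← mul_pow, q2]
  have t1 : ∀ j, 2 ^ j * f j ≤ B * √u * √2 ^ j := by
    intro j
    have hq : 0 < √2 ^ j := by positivity
    calc (2:ℝ) ^ j * f j ≤ 2 ^ j * (B * (√u / √2 ^ j)) := by gcongr; exact h1 j
      _ = _ := by rw [pw]; field_simp
  have t2 : ∀ j, 2 ^ j * f j ≤ B * u ^ 2 / 2 ^ j := by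
    intro j
    calc (2:ℝ) ^ j * f j ≤ 2 ^ j * (B * (u / 2 ^ j) ^ 2) := by gcongr; exact h2 j
      _ = _ := by field_simp
  have s1 : ∀ n, ∑ j ∈ Finset.range n, 2 ^ j * f j ≤ 3 * (B * √u) * √2 ^ n := by
    intro n
    induction n with
    | zero => simp; positivity
    | succ n ih =>
      rw [Finset.sum_range_succ, pow_succ]
      have := t1 n
      have h0 : 0 ≤ B * √u * √2 ^ n := by positivity
      nlinarith
  have s2 : ∀ n, J + 1 ≤ n → ∑ j ∈ Finset.range n, 2 ^ j * f j ≤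
      3 * (B * √u) * √2 ^ (J+1) + B * u ^ 2 * (2 / 2 ^ (J+1) - 2 / 2 ^ n) := by
    intro n hn
    induction n, hn using Nat.le_induction with
    | base => simpa using s1 (J+1)
    | succ n hn ih =>
      rw [Finset.sum_range_succ]
      have := t2 n
      have e : B * u ^ 2 * (2 / 2 ^ (J+1) - 2 / 2 ^ (n+1)) =
          B * u ^ 2 * (2 / 2 ^ (J+1) - 2 / 2 ^ n) + B * u ^ 2 / 2 ^ n := by
        rw [pow_succ 2 n]; field_simp; ring
      rw [e]; linarith
  have mono : ∑ j ∈ Finset.range N, 2 ^ j * f j ≤ ∑ j ∈ Finset.range (max N (J+1)), 2 ^ j * f j := by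
    refine Finset.sum_le_sum_of_subset_of_nonneg ?_ fun j _ _ => mul_nonneg (by positivity) (hf j)
    exact Finset.range_subset_range.2 (le_max_left _ _)
  refine mono.trans ((s2 _ (le_max_right _ _)).trans ?_)
  have a1 : √u * √2 ^ (J+1) ≤ 2 * u := by
    have : √2 ^ J ≤ √u := by
      apply Real.le_sqrt_of_sq_le
      rw [sq, ← pw]; exact hJ1
    have q15 : √2 ≤ 2 := by nlinarith
    rw [pow_succ]
    calc √u * (√2 ^ J * √2) ≤ √u * (√u * 2) := by gcongr
      _ = 2 * (√u * √u) := by ring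
      _ = 2 * u := by rw [Real.mul_self_sqrt (by linarith)]
  have a2 : u ^ 2 * (2 / 2 ^ (J+1) - 2 / 2 ^ (max N (J+1))) ≤ 2 * u := by
    have : u ^ 2 * (2 / 2 ^ (J+1)) ≤ 2 * u := by
      rw [mul_div_assoc', div_le_iff₀ (by positivity)]
      nlinarith
    have h3 : 0 ≤ u ^ 2 * (2 / 2 ^ (max N (J+1))) := by positivity
    linarith
  calc _ = 3 * B * (√u * √2 ^ (J+1)) + B * (u ^ 2 * (2 / 2 ^ (J+1) - 2 / 2 ^ (max N (J+1)))) := by ring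
    _ ≤ 3 * B * (2 * u) + B * (2 * u) := by gcongr
    _ = _ := by ring

lemma lower {Ω : Type*} {m0 : MeasurableSpace Ω} (P : Measure Ω)
    [IsProbabilityMeasure P]
    (H β : ℝ) (hβ : 0 < β) (hβH : β < H) (hH : H < 1)
    (X : ℝ → Ω → ℝ)
    (hmeas : ∀ t, Measurable (X t))
    (hcont : ∀ ω, Continuous fun t => X t ω)
    (hgauss : ∀ (n : ℕ) (c : Fin n → ℝ) (t : Fin n → ℝ),
      ∃ v : NNReal, P.map (fun ω => ∑ i, c i * X (t i) ω) = gaussianReal 0 v)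
    (hcov : ∀ s t : ℝ, ∫ ω, X s ω * X t ω ∂P =
      (1/2) * (|s| ^ (2*H) + |t| ^ (2*H) - |t - s| ^ (2*H))) :
    ∃ K : ℝ, 0 < K ∧ ∀ ε : ℝ, 0 < ε → ε < 1 →
      Real.exp (-(K * ε ^ (-(1/(H - β))))) ≤ P.real {ω | ∀ s ∈ Set.Icc (0:ℝ) 1, ∀ t ∈ Set.Icc (0:ℝ) 1,
            s < t → |X t ω - X s ω| ≤ ε * (t - s) ^ β} := by
  have hκ : 0 < H - β := by linarith
  have hH0 : 0 < H := by linarith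
  set κ := H - β with hκdef
  set m : ℝ := 3 / κ with hm
  have hm1 : 1 ≤ m := by rw [hm, le_div_iff₀ hκ]; linarith
  set r : ℝ := (1/2) ^ β with hr
  have hr0 : 0 < r := by positivity
  have hr1 : r < 1 := Real.rpow_lt_one (by norm_num) (by norm_num) hβ
  set C0 : ℝ := (1 + 2 / (1 - r)) * r⁻¹ with hC0
  have h1r : 0 < 1 - r := by linarith
  have hC0p : 0 < C0 := by positivity
  set M : ℝ := ∫ x, |x| ^ m ∂(gaussianReal 0 1) with hM
  have hM0 : 0 ≤ M := integral_nonneg fun x => by positivity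
  set C : ℝ := (√2 * C0) ^ m * M with hC
  have hCn : 0 ≤ C := by positivity
  refine ⟨8 * (12 + 3 * C), by positivity, fun ε hε hε1 => ?_⟩
  set u : ℝ := ε ^ (-(1/κ)) with hu
  have hu1 : 1 ≤ u := Real.one_le_rpow_of_pos_of_le_one_of_nonpos hε hε1.le (by
    have : 0 < 1 / κ := by positivity
    linarith)
  have hu0 : 0 < u := by linarith
  set A : ℝ := ε / C0 with hA
  have hA0 : 0 < A := by positivity
  let E : ℕ → Set Ω := fun N => {ω | ∀ i : (Σ j : Fin N, Fin (2 ^ (j : ℕ))),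
    |X (((i.2 : ℕ) + 1 : ℝ) / 2 ^ (i.1 : ℕ)) ω - X (((i.2 : ℕ) : ℝ) / 2 ^ (i.1 : ℕ)) ω| ≤
      A * r ^ (i.1 : ℕ)}
  -- probability of finite level events
  have hEN : ∀ N, Real.exp (-(8 * (12 + 3 * C) * u)) ≤ P.real (E N) := by
    intro N
    set p : ℕ → ℝ := fun j => (u / 2 ^ j) ^ 3 with hp
    have hp0 : ∀ j, 0 < p j := fun j => by positivity
    have mom : ∀ (j k : ℕ), 
      Integrable (fun ω => |2 * ((X (((k : ℝ) + 1) / 2 ^ j) ω - X ((k : ℝ) / 2 ^ j) ω) / (√2 * (A * r ^ j)))| ^ m) P ∧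
      ∫ ω, |2 * ((X (((k : ℝ) + 1) / 2 ^ j) ω - X ((k : ℝ) / 2 ^ j) ω) / (√2 * (A * r ^ j)))| ^ m ∂P ≤ C / (p j)⁻¹ := by
      intro j k
      set σ : ℝ := ((1/2 : ℝ) ^ j) ^ H with hσ
      have hlaw := incr_law hmeas hgauss hcov hH0 ((k : ℝ) / 2 ^ j) (((k : ℝ) + 1) / 2 ^ j)
      have e1 : |((k : ℝ) + 1) / 2 ^ j - (k : ℝ) / 2 ^ j| ^ (2 * H) = σ ^ 2 := by
        have : ((k : ℝ) + 1) / 2 ^ j - (k : ℝ) / 2 ^ j = (1/2) ^ j := by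
          rw [div_pow, one_pow]; ring
        rw [this, abs_of_pos (by positivity), hσ, ← Real.rpow_natCast (_ ^ H), ← Real.rpow_mul (by positivity)]
        congr 1; push_cast; ring
      rw [e1] at hlaw
      have hg := gauss_moment P _ ((hmeas _).sub (hmeas _)) σ (by positivity) hlaw m hm1
        (2 / (√2 * (A * r ^ j)))
      have e2 : ∀ ω, 2 * ((X (((k : ℝ) + 1) / 2 ^ j) ω - X ((k : ℝ) / 2 ^ j) ω) / (√2 * (A * r ^ j))) =
        2 / (√2 * (A * r ^ j)) * (X (((k : ℝ) + 1) / 2 ^ j) ω - X ((k : ℝ) / 2 ^ j) ω) := fun ω => by ring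
      simp_rw [e2]
      refine ⟨hg.1, hg.2.le.trans (le_of_eq ?_)⟩
      have q2 : √2 * √2 = 2 := Real.mul_self_sqrt (by norm_num)
      have e3 : |2 / (√2 * (A * r ^ j))| * σ = √2 * C0 * (ε⁻¹ * ((1/2 : ℝ) ^ j) ^ κ) := by
        rw [abs_of_pos (by positivity), hκdef, Real.rpow_sub (by positivity), ← hσ]
        have : ((1/2 : ℝ) ^ j) ^ β = r ^ j := by
          rw [hr, ← Real.rpow_natCast, ← Real.rpow_natCast, ← Real.rpow_mul (by norm_num),
            ← Real.rpow_mul (by norm_num), mul_comm]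
        rw [this, hA]
        nth_rw 1 [← q2]
        field_simp
      have e4 : (ε⁻¹ * ((1/2 : ℝ) ^ j) ^ κ) ^ m = p j := by
        rw [Real.mul_rpow (by positivity) (by positivity), ← Real.rpow_mul (by positivity)]
        change _ = (u / 2 ^ j) ^ 3
        have : κ * m = (3 : ℕ) := by rw [hm]; field_simp; norm_num
        rw [this, Real.rpow_natCast, div_pow u, hu, ← Real.rpow_natCast (ε ^ _), ← Real.rpow_mul hε.le,
          Real.inv_rpow hε.le, ← Real.rpow_neg hε.le]
        have : -(1 / κ) * ((3:ℕ) : ℝ) = -m := by rw [hm]; push_cast; ring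
        rw [this, div_pow 1, one_pow]
        field_simp
      rw [e3, Real.mul_rpow (by positivity) (by positivity), e4, hC, div_inv_eq_mul]
      ring
    have hsb := small_ball P
      (fun (i : (Σ j : Fin N, Fin (2 ^ (j : ℕ)))) ω => X (((i.2 : ℕ) + 1 : ℝ) / 2 ^ (i.1 : ℕ)) ω -
        X (((i.2 : ℕ) : ℝ) / 2 ^ (i.1 : ℕ)) ω) (fun i => (hmeas _).sub (hmeas _))
      (fam_gauss hgauss ![1, -1] (fun i => ![((i.2 : ℕ) + 1 : ℝ) / 2 ^ (i.1 : ℕ),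
        ((i.2 : ℕ) : ℝ) / 2 ^ (i.1 : ℕ)]) _ (fun i ω => by simp [Fin.sum_univ_two]; ring))
      (fun i => A * r ^ (i.1 : ℕ)) (fun i => (p i.1)⁻¹) (fun i => by positivity)
      (fun i => by have := hp0 i.1; positivity) C m hm1 (fun i => (mom i.1 i.2).1) (fun i => (mom i.1 i.2).2)
    refine le_trans ?_ hsb
    rw [Real.exp_le_exp, neg_le_neg_iff, Fintype.sum_sigma]
    simp only [Finset.sum_const, Finset.card_univ, Fintype.card_fin, nsmul_eq_mul]
    rw [Fin.sum_univ_eq_sum_range (fun j => ((2 ^ j : ℕ) : ℝ) * (Real.log (1 + 2 / (p j)⁻¹) + C / (p j)⁻¹ * Real.log (1 + (p j)⁻¹)))]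
    push_cast
    refine sum_bound (fun j => Real.log (1 + 2 / (p j)⁻¹) + C / (p j)⁻¹ * Real.log (1 + (p j)⁻¹))
      u (12 + 3 * C) hu1 (by positivity) (fun j => ?_) (fun j => ?_) N (fun j => ?_)
    · refine (cost_bound (hp0 j) hCn (s := 1/6) (by norm_num) (by norm_num)).trans (le_of_eq ?_)
      congr 1
      rw [hp]
      simp only
      rw [← Real.rpow_natCast (u / 2 ^ j), ← Real.rpow_mul (by positivity)]
      have : ((3:ℕ):ℝ) * (1/6) = 1/2 := by norm_num
      rw [this, ← Real.sqrt_eq_rpow, Real.sqrt_div hu0.le]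
      congr 1
      rw [Real.sqrt_eq_iff_mul_self_eq (by positivity) (by positivity), ← mul_pow]
      simp
    · refine (cost_bound (hp0 j) hCn (s := 2/3) (by norm_num) (by norm_num)).trans (le_of_eq ?_)
      congr 1
      rw [hp]
      simp only
      rw [← Real.rpow_natCast (u / 2 ^ j), ← Real.rpow_mul (by positivity), ← Real.rpow_natCast (u / 2 ^ j)]
      congr 1; norm_num
    · have := hp0 j
      have h1 : 0 ≤ Real.log (1 + 2 / (p j)⁻¹) := Real.log_nonneg (by
        have : 0 < 2 / (p j)⁻¹ := by positivity
        linarith)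
      have h2 : 0 ≤ Real.log (1 + (p j)⁻¹) := Real.log_nonneg (by
        have : 0 < (p j)⁻¹ := by positivity
        linarith)
      positivity
  -- limit
  have hEm : ∀ N, MeasurableSet (E N) := by
    intro N
    have : E N = ⋂ i : (Σ j : Fin N, Fin (2 ^ (j : ℕ))),
      {ω | |X (((i.2 : ℕ) + 1 : ℝ) / 2 ^ (i.1 : ℕ)) ω - X (((i.2 : ℕ) : ℝ) / 2 ^ (i.1 : ℕ)) ω| ≤
      A * r ^ (i.1 : ℕ)} := by
      ext ω; simp [E]
    rw [this]
    refine MeasurableSet.iInter fun i => ?_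
    exact measurableSet_le (((hmeas _).sub (hmeas _)).abs) measurable_const
  have hEa : Antitone E := by
    intro N N' hN ω hω i
    exact hω ⟨⟨i.1, lt_of_lt_of_le i.1.2 hN⟩, i.2⟩
  have hlim := tendsto_measure_iInter_atTop (μ := P) (fun N => (hEm N).nullMeasurableSet) hEa
    ⟨0, measure_ne_top _ _⟩
  have hlim' := (ENNReal.tendsto_toReal (measure_ne_top P _)).comp hlim
  have hle : Real.exp (-(8 * (12 + 3 * C) * u)) ≤ P.real (⋂ N, E N) :=
    ge_of_tendsto' hlim' fun N => hEN N
  refine hle.trans (measureReal_mono ?_)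
  intro ω hω
  simp only [Set.mem_iInter] at hω
  intro s hs t ht hst
  obtain ⟨n, hn, hx⟩ := chain (fun t => X t ω) (hcont ω) A r hA0.le hr0 hr1 (by
    intro j k hk
    exact hω (j+1) ⟨⟨j, Nat.lt_succ_self j⟩, ⟨k, hk⟩⟩) s t hs ht hst
  refine hx.trans ?_
  have e5 : r ^ (n + 1) ≤ (t - s) ^ β := by
    have : r ^ (n+1) = ((1/2 : ℝ) ^ (n+1)) ^ β := by
      rw [hr, ← Real.rpow_natCast, ← Real.rpow_natCast, ← Real.rpow_mul (by norm_num),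
            ← Real.rpow_mul (by norm_num), mul_comm]
    rw [this]
    exact Real.rpow_le_rpow (by positivity) hn.le hβ.le
  have e6 : A * (1 + 2 / (1 - r)) * r ^ n = ε * r ^ (n+1) := by
    rw [hA, hC0, pow_succ]; field_simp
  rw [e6]
  gcongr

end FbmSB


namespace FbmSB

/-- iterated forward differences of the power function -/
noncomputable def fdiff : ℕ → ℝ → ℝ → ℝ
  | 0, q, x => x ^ q
  | k + 1, q, x => fdiff k q (x + 1) - fdiff k q x

lemma fdiff_deriv (k : ℕ) : ∀ (q x : ℝ), 0 < x →
    HasDerivAt (fdiff k q) (q * fdiff k (q - 1) x) x := by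
  induction k with
  | zero =>
    intro q x hx
    exact Real.hasDerivAt_rpow_const (Or.inl hx.ne')
  | succ k ih =>
    intro q x hx
    have h1 := (ih q (x + 1) (by linarith)).comp_add_const x 1
    have h2 := h1.sub (ih q x hx)
    rw [← mul_sub] at h2
    exact h2

lemma fdiff_bound (k : ℕ) : ∀ q : ℝ, q ≤ k → ∃ C : ℝ, 0 ≤ C ∧ ∀ x : ℝ, 0 < x →
    |fdiff k q x| ≤ C * x ^ (q - k) := by
  induction k with
  | zero =>
    intro q _
    refine ⟨1, zero_le_one, fun x hx => ?_⟩
    simp only [fdiff, Nat.cast_zero, sub_zero, one_mul]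
    rw [abs_of_pos (by positivity)]
  | succ k ih =>
    intro q hq
    push_cast at hq
    obtain ⟨C, hC, h⟩ := ih (q - 1) (by linarith)
    refine ⟨|q| * C, by positivity, fun x hx => ?_⟩
    obtain ⟨ξ, hξ, he⟩ := exists_hasDerivAt_eq_slope (fdiff k q) (fun y => q * fdiff k (q - 1) y)
      (show x < x + 1 by linarith)
      (fun y hy => (fdiff_deriv k q y (by linarith [hy.1])).continuousAt.continuousWithinAt)
      (fun y hy => fdiff_deriv k q y (by linarith [hy.1]))
    have e1 : fdiff (k + 1) q x = q * fdiff k (q - 1) ξ := by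
      rw [he]; simp [fdiff]
    rw [e1, abs_mul, mul_assoc]
    have hξ0 : 0 < ξ := by linarith [hξ.1]
    gcongr
    refine (h ξ hξ0).trans ?_
    have : ξ ^ (q - 1 - k) ≤ x ^ (q - 1 - k) :=
      Real.rpow_le_rpow_of_nonpos hx hξ.1.le (by linarith)
    have e2 : q - ((k + 1 : ℕ) : ℝ) = q - 1 - k := by push_cast; ring
    rw [e2]
    gcongr

/-- covariance of second differences -/
noncomputable def gam (p d : ℝ) : ℝ :=
  -(1/2) * (|d + 2| ^ p - 4 * |d + 1| ^ p + 6 * |d| ^ p - 4 * |d - 1| ^ p + |d - 2| ^ p)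

lemma gam_abs (p d : ℝ) : gam p |d| = gam p d := by
  rcases abs_cases d with ⟨h, _⟩ | ⟨h, _⟩
  · rw [h]
  · rw [h]
    simp only [gam]
    rw [show |-d + 2| = |d - 2| by rw [← abs_neg]; congr 1; ring,
      show |-d + 1| = |d - 1| by rw [← abs_neg]; congr 1; ring,
      show |-d - 1| = |d + 1| by rw [← abs_neg]; congr 1; ring,
      show |-d - 2| = |d + 2| by rw [← abs_neg]; congr 1; ring, abs_neg]
    ring

lemma gam_bound {p : ℝ} (hp : p < 2) : ∃ C : ℝ, 0 ≤ C ∧ ∀ d : ℝ, 4 ≤ |d| →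
    |gam p d| ≤ C / d ^ 2 := by
  obtain ⟨C, hC, h⟩ := fdiff_bound 4 p (by norm_num; linarith)
  refine ⟨2 * C, by positivity, fun d hd => ?_⟩
  rw [← gam_abs, ← sq_abs]
  set x := |d| with hx
  have e : gam p x = -(1/2) * fdiff 4 p (x - 2) := by
    simp only [gam, fdiff]
    rw [abs_of_pos (by linarith : 0 < x + 2), abs_of_pos (by linarith : 0 < x + 1),
      abs_of_pos (by linarith : 0 < x), abs_of_pos (by linarith : 0 < x - 1),
      abs_of_pos (by linarith : 0 < x - 2)]
    rw [show x - 2 + 1 + 1 + 1 + 1 = x + 2 by ring, show x - 2 + 1 + 1 + 1 = x + 1 by ring,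
      show x - 2 + 1 + 1 = x by ring, show x - 2 + 1 = x - 1 by ring]
    ring
  rw [e, abs_mul]
  have h1 := h (x - 2) (by linarith)
  have h2 : (x - 2) ^ (p - (4 : ℕ)) ≤ (x - 2) ^ (-2 : ℝ) :=
    Real.rpow_le_rpow_of_exponent_le (by linarith) (by push_cast; linarith)
  have h3 : (x - 2) ^ (-2 : ℝ) = 1 / (x - 2) ^ 2 := by
    rw [Real.rpow_neg (by linarith), one_div]
    norm_cast
  have h4 : 1 / (x - 2) ^ 2 ≤ 4 / x ^ 2 := by
    rw [div_le_div_iff₀ (by nlinarith) (by nlinarith)]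
    nlinarith
  have h5 : |-(1/2 : ℝ)| = 1/2 := by rw [abs_neg]; norm_num
  rw [h5]
  calc 1 / 2 * |fdiff 4 p (x - 2)| ≤ 1 / 2 * (C * (4 / x ^ 2)) := by
        gcongr
        refine h1.trans ?_
        gcongr
        exact h2.trans (h3.le.trans h4)
    _ = _ := by ring

lemma quad_form : ∃ B : ℝ, 0 ≤ B ∧ ∀ (n : ℕ) (G : Fin n → Fin n → ℝ) (g e : ℝ), 0 ≤ e → 
    (∀ k, G k k = g) → (∀ k l, k ≠ l → |G k l| ≤ e / ((k : ℝ) - (l : ℝ)) ^ 2) → B * e ≤ g / 2 →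
    ∀ c : Fin n → ℝ, g / 2 * ∑ k, c k ^ 2 ≤ ∑ k, ∑ l, c k * c l * G k l := by
  have hs : Summable (fun j : ℤ => 1 / (j : ℝ) ^ 2) := Real.summable_one_div_int_pow.2 one_lt_two
  refine ⟨∑' j : ℤ, 1 / (j : ℝ) ^ 2, tsum_nonneg fun j => by positivity, ?_⟩
  set B := ∑' j : ℤ, 1 / (j : ℝ) ^ 2 with hB
  intro n G g e he hd ho hBe c
  set h : Fin n → Fin n → ℝ := fun k l => 1 / ((k : ℝ) - (l : ℝ)) ^ 2 with hh
  have row : ∀ k, ∑ l, h k l ≤ B := by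
    intro k
    have inj : Function.Injective (fun l : Fin n => ((k : ℕ) : ℤ) - ((l : ℕ) : ℤ)) := by
      intro l l' hl
      simp only at hl
      exact Fin.ext (by omega)
    have e1 : ∑ l, h k l = ∑ j ∈ Finset.univ.map ⟨_, inj⟩, 1 / (j : ℝ) ^ 2 := by
      rw [Finset.sum_map]
      refine Finset.sum_congr rfl fun l _ => ?_
      simp [hh]
    rw [e1]
    exact hs.sum_le_tsum _ fun j _ => by positivity
  have sym : ∀ k l, h k l = h l k := by
    intro k l
    simp only [hh]
    congr 1; ring
  have term : ∀ k l, (if k = l then g * c k ^ 2 else 0) - e / 2 * (c k ^ 2 * h k l) - e / 2 * (c l ^ 2 * h l k)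
      ≤ c k * c l * G k l := by
    intro k l
    by_cases hkl : k = l
    · subst hkl
      rw [if_pos rfl, hd]
      have : h k k = 0 := by simp [hh]
      rw [this]
      linarith
    · rw [if_neg hkl, sym l k]
      have h1 := ho k l hkl
      have h2 : |c k * c l| ≤ (c k ^ 2 + c l ^ 2) / 2 := by
        rw [abs_le]; constructor <;> nlinarith [sq_nonneg (c k + c l), sq_nonneg (c k - c l)]
      have h3 : |c k * c l * G k l| ≤ (c k ^ 2 + c l ^ 2) / 2 * (e * h k l) := by
        rw [abs_mul]
        have : e * h k l = e / ((k : ℝ) - (l : ℝ)) ^ 2 := by simp only [hh]; ring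
        rw [this]
        exact mul_le_mul h2 h1 (abs_nonneg _) (by positivity)
      have := (abs_le.1 h3).1
      linarith
  have S := Finset.sum_le_sum fun k (_ : k ∈ Finset.univ) =>
    Finset.sum_le_sum fun l (_ : l ∈ Finset.univ) => term k l
  refine le_trans ?_ S
  simp only [Finset.sum_sub_distrib, Finset.sum_ite_eq, Finset.mem_univ, if_true]
  have s1 : ∑ k, ∑ l, e / 2 * (c k ^ 2 * h k l) ≤ e / 2 * (B * ∑ k, c k ^ 2) := by
    rw [Finset.mul_sum, Finset.mul_sum]
    refine Finset.sum_le_sum fun k _ => ?_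
    rw [← Finset.mul_sum, ← Finset.mul_sum]
    have := row k
    have hc := sq_nonneg (c k)
    rw [mul_comm B]
    gcongr
  have s2 : ∑ k, ∑ l, e / 2 * (c l ^ 2 * h l k) ≤ e / 2 * (B * ∑ k, c k ^ 2) := by
    rw [Finset.sum_comm]; exact s1
  have hc : 0 ≤ ∑ k, c k ^ 2 := Finset.sum_nonneg fun k _ => sq_nonneg _
  rw [← Finset.mul_sum]
  nlinarith

lemma gauss_int {b : ℝ} (hb : 0 < b) :
    ∫ x, Real.exp (-b * x ^ 2) ∂(gaussianReal 0 1) = 1 / √(1 + 2 * b) := by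
  rw [integral_gaussianReal_eq_integral_smul one_ne_zero]
  have : ∀ x : ℝ, gaussianPDFReal 0 1 x • Real.exp (-b * x ^ 2) =
      (√(2 * Real.pi))⁻¹ * Real.exp (-(b + 1/2) * x ^ 2) := by
    intro x
    simp only [gaussianPDFReal, NNReal.coe_one, mul_one, sub_zero, smul_eq_mul]
    rw [mul_assoc, ← Real.exp_add]
    congr 2; ring
  simp_rw [this]
  rw [integral_const_mul, integral_gaussian, ← Real.sqrt_inv, ← Real.sqrt_mul (by positivity),
    one_div (√_), ← Real.sqrt_inv]
  congr 1
  have := Real.pi_pos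
  field_simp
  ring

lemma cheb {Ω : Type*} {m0 : MeasurableSpace Ω} (P : Measure Ω)
    [IsProbabilityMeasure P] {n : ℕ} (D : Fin n → Ω → ℝ)
    (hD : ∀ i, Measurable (D i)) (c0 : ℝ) (hc0 : 0 < c0)
    (hG : ∀ c : Fin n → ℝ, ∃ v : NNReal, P.map (fun ω => ∑ i, c i * D i ω) = gaussianReal 0 v ∧
      c0 * ∑ i, c i ^ 2 ≤ v) (M lam : ℝ) (hlam : 0 < lam) :
    P.real {ω | ∀ i, |D i ω| ≤ M} ≤ (Real.exp (lam * M ^ 2) / √(1 + 2 * (lam * c0))) ^ n := by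
  set s := √(2 * lam) with hs
  have hs2 : s ^ 2 = 2 * lam := Real.sq_sqrt (by positivity)
  set ν : Measure (Fin n → ℝ) := Measure.pi (fun _ => gaussianReal 0 1) with hν
  set F : Ω → (Fin n → ℝ) → ℂ := fun ω g => Complex.exp ((s * ∑ i, g i * D i ω : ℝ) * Complex.I) with hF
  have h1 : ∀ ω, ∫ g, F ω g ∂ν = (Real.exp (-lam * ∑ i, D i ω ^ 2) : ℝ) := by
    intro ω
    have e1 : ∀ g, F ω g = ∏ i, Complex.exp (((s * D i ω) * g i : ℝ) * Complex.I) := by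
      intro g
      rw [← Complex.exp_sum]
      simp only [hF]
      congr 1
      rw [← Finset.sum_mul, Finset.mul_sum, Complex.ofReal_sum]
      congr 1
      refine Finset.sum_congr rfl fun i _ => ?_
      congr 1; ring
    simp_rw [e1]
    rw [hν, integral_fintype_prod_eq_prod (fun i (x : ℝ) => Complex.exp (((s * D i ω) * x : ℝ) * Complex.I))]
    have e2 : ∀ i, ∫ x, Complex.exp (((s * D i ω) * x : ℝ) * Complex.I) ∂(gaussianReal 0 1) =
        (Real.exp (-lam * D i ω ^ 2) : ℝ) := by
      intro i
      rw [integral_cexp_gauss (gaussianReal 0 1) (fun x => x) measurable_id 1 Measure.map_id]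
      rw [Complex.ofReal_exp]
      congr 1
      norm_cast
      rw [mul_pow, hs2]
      ring
    simp_rw [e2]
    rw [← Complex.ofReal_prod, ← Real.exp_sum, Finset.mul_sum]
  have hFm : Measurable (Function.uncurry F) := by
    simp only [hF, Function.uncurry_def]
    refine Complex.measurable_exp.comp ((Complex.measurable_ofReal.comp (Measurable.const_mul ?_ _)).mul_const _)
    refine Finset.measurable_sum _ fun i _ => ?_
    exact ((measurable_pi_apply i).comp measurable_snd).mul ((hD i).comp measurable_fst)
  have hFn : ∀ ω g, ‖F ω g‖ = 1 := fun ω g => Complex.norm_exp_ofReal_mul_I _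
  have hFi : Integrable (Function.uncurry F) (P.prod ν) :=
    Integrable.of_bound (C := 1) hFm.aestronglyMeasurable (ae_of_all _ fun p => (hFn p.1 p.2).le)
  have hswap := integral_integral_swap hFi
  have h2 : ((∫ ω, Real.exp (-lam * ∑ i, D i ω ^ 2) ∂P : ℝ) : ℂ) = ∫ g, ∫ ω, F ω g ∂P ∂ν := by
    rw [← hswap]
    simp_rw [h1]
    exact integral_ofReal.symm
  have h3 : ∀ g, ‖∫ ω, F ω g ∂P‖ ≤ ∏ i, Real.exp (-(lam * c0) * g i ^ 2) := by
    intro g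
    obtain ⟨v, hv, hvc⟩ := hG g
    have : ∫ ω, F ω g ∂P = _ := integral_cexp_gauss P (fun ω => ∑ i, g i * D i ω)
      (Finset.measurable_sum _ fun i _ => (hD i).const_mul _) v hv s
    rw [this, Complex.norm_exp, ← Real.exp_sum, Real.exp_le_exp, ← Finset.mul_sum]
    have e : (-((v : ℂ) * (s : ℂ) ^ 2 / 2)).re = -((v : ℝ) * s ^ 2 / 2) := by
      rw [← Complex.ofReal_re (-((v : ℝ) * s ^ 2 / 2))]
      push_cast; rfl
    rw [e, hs2]
    nlinarith
  have h4 : ∫ ω, Real.exp (-lam * ∑ i, D i ω ^ 2) ∂P ≤ (1 / √(1 + 2 * (lam * c0))) ^ n := by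
    have p0 : 0 ≤ ∫ ω, Real.exp (-lam * ∑ i, D i ω ^ 2) ∂P := integral_nonneg fun ω => by positivity
    have e1 : ∫ ω, Real.exp (-lam * ∑ i, D i ω ^ 2) ∂P = ‖∫ g, ∫ ω, F ω g ∂P ∂ν‖ := by
      rw [← h2, Complex.norm_real, Real.norm_of_nonneg p0]
    have e2 : ∫ g, ∏ i, Real.exp (-(lam * c0) * g i ^ 2) ∂ν = (1 / √(1 + 2 * (lam * c0))) ^ n := by
      rw [hν, integral_fintype_prod_eq_prod (fun (i : Fin n) (x : ℝ) => Real.exp (-(lam * c0) * x ^ 2))]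
      simp_rw [gauss_int (mul_pos hlam hc0)]
      simp
    rw [e1, ← e2]
    refine norm_integral_le_of_norm_le ?_ (ae_of_all _ h3)
    refine Integrable.of_bound (C := 1) ?_ (ae_of_all _ fun g => ?_)
    · exact (Measurable.aestronglyMeasurable (by fun_prop))
    · rw [Real.norm_of_nonneg (Finset.prod_nonneg fun i _ => (Real.exp_pos _).le)]
      refine Finset.prod_le_one (fun i _ => (Real.exp_pos _).le) fun i _ => ?_
      rw [Real.exp_le_one_iff]
      have := mul_pos hlam hc0
      nlinarith [sq_nonneg (g i)]
  have mF : MeasurableSet {ω | ∀ i, |D i ω| ≤ M} := by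
    rw [Set.ofPred_forall]
    exact MeasurableSet.iInter fun i => measurableSet_le (hD i).abs measurable_const
  have h5 : P.real {ω | ∀ i, |D i ω| ≤ M} * Real.exp (-lam * (n * M ^ 2)) ≤
      ∫ ω, Real.exp (-lam * ∑ i, D i ω ^ 2) ∂P := by
    have iE : Integrable (fun ω => Real.exp (-lam * ∑ i, D i ω ^ 2)) P := by
      refine Integrable.of_bound (C := 1) ?_ (ae_of_all _ fun ω => ?_)
      · exact (Real.measurable_exp.comp ((Finset.measurable_sum _ fun i _ =>
          (hD i).pow_const 2).const_mul _)).aestronglyMeasurable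
      · rw [Real.norm_of_nonneg (Real.exp_pos _).le, Real.exp_le_one_iff]
        have : 0 ≤ ∑ i, D i ω ^ 2 := Finset.sum_nonneg fun i _ => sq_nonneg _
        nlinarith
    rw [← smul_eq_mul, ← integral_indicator_const _ mF]
    refine integral_mono ((integrable_const _).indicator mF) iE fun ω => ?_
    by_cases hω : ω ∈ {ω | ∀ i, |D i ω| ≤ M}
    · rw [Set.indicator_of_mem hω]
      simp only
      rw [Real.exp_le_exp]
      have : ∑ i, D i ω ^ 2 ≤ n * M ^ 2 := by
        have h := Finset.sum_le_sum fun i (_ : i ∈ Finset.univ) =>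
          (show D i ω ^ 2 ≤ M ^ 2 from by
            rw [← sq_abs (D i ω)]; exact pow_le_pow_left₀ (abs_nonneg _) (hω i) 2)
        simpa using h
      nlinarith
    · rw [Set.indicator_of_notMem hω]
      positivity
  have h6 := h5.trans h4
  have e3 : Real.exp (-lam * (n * M ^ 2)) = (Real.exp (lam * M ^ 2) ^ n)⁻¹ := by
    rw [← Real.exp_nat_mul, ← Real.exp_neg]; congr 1; ring
  rw [e3, ← div_eq_mul_inv, div_le_iff₀ (by positivity)] at h6
  refine h6.trans (le_of_eq ?_)
  rw [div_pow, div_pow, one_pow]; ring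

end FbmSB


namespace FbmSB

lemma second_var {Ω : Type*} {m0 : MeasurableSpace Ω} {P : Measure Ω}
    [IsProbabilityMeasure P] {H : ℝ} {X : ℝ → Ω → ℝ}
    (hmeas : ∀ t, Measurable (X t))
    (hgauss : ∀ (n : ℕ) (c : Fin n → ℝ) (t : Fin n → ℝ),
      ∃ v : NNReal, P.map (fun ω => ∑ i, c i * X (t i) ω) = gaussianReal 0 v)
    (hcov : ∀ s t : ℝ, ∫ ω, X s ω * X t ω ∂P =
      (1/2) * (|s| ^ (2*H) + |t| ^ (2*H) - |t - s| ^ (2*H)))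
    (δ L : ℝ) (hδ : 0 < δ) (n : ℕ) (c : Fin n → ℝ) :
    ∃ v : NNReal, P.map (fun ω => ∑ k : Fin n, c k * (X (δ * (L * (k : ℕ) + 2)) ω
      - 2 * X (δ * (L * (k : ℕ) + 1)) ω + X (δ * (L * (k : ℕ))) ω)) = gaussianReal 0 v ∧
      (v : ℝ) = δ ^ (2 * H) * ∑ k, ∑ l, c k * c l * gam (2 * H) (L * ((k : ℕ) - (l : ℕ))) := by
  obtain ⟨v, hv⟩ := comb_gauss hgauss (J := Fin n × Fin 3)
    (fun q => c q.1 * (![1, -2, 1] : Fin 3 → ℝ) q.2)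
    (fun q => δ * (L * ((q.1 : ℕ) : ℝ) + (![0, 1, 2] : Fin 3 → ℝ) q.2))
  have hvar := comb_var hmeas hgauss hcov _ _ v hv
  refine ⟨v, ?_, ?_⟩
  · rw [← hv]
    congr 1
    ext ω
    rw [Fintype.sum_prod_type]
    refine Finset.sum_congr rfl fun k _ => ?_
    simp [Fin.sum_univ_three]
    ring
  · rw [hvar, Fintype.sum_prod_type, Finset.mul_sum]
    refine Finset.sum_congr rfl fun k _ => ?_
    simp_rw [Fintype.sum_prod_type]
    rw [Finset.sum_comm, Finset.mul_sum]
    refine Finset.sum_congr rfl fun l _ => ?_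
    have hsc : ∀ x : ℝ, |δ * x| ^ (2 * H) = δ ^ (2 * H) * |x| ^ (2 * H) := fun x => by
      rw [abs_mul, abs_of_pos hδ, Real.mul_rpow hδ.le (abs_nonneg _)]
    simp only [← mul_sub, hsc, Fin.sum_univ_three, Matrix.cons_val_zero, Matrix.cons_val_one,
      Matrix.cons_val, gam]
    set a := L * ((k : ℕ) : ℝ) with ha
    set b := L * ((l : ℕ) : ℝ) with hb
    rw [show L * (((k : ℕ) : ℝ) - ((l : ℕ) : ℝ)) = a - b by rw [ha, hb]; ring]
    have z0 : |b + 0 - (a + 0)| = |a - b| := by rw [abs_sub_comm]; congr 1; ring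
    have z1 : |b + 1 - (a + 1)| = |a - b| := by rw [abs_sub_comm]; congr 1; ring
    have z2 : |b + 2 - (a + 2)| = |a - b| := by rw [abs_sub_comm]; congr 1; ring
    have z3 : |b + 1 - (a + 0)| = |a - b - 1| := by rw [abs_sub_comm]; congr 1; ring
    have z4 : |b + 2 - (a + 1)| = |a - b - 1| := by rw [abs_sub_comm]; congr 1; ring
    have z5 : |b + 2 - (a + 0)| = |a - b - 2| := by rw [abs_sub_comm]; congr 1; ring
    have z6 : |b + 0 - (a + 1)| = |a - b + 1| := by rw [abs_sub_comm]; congr 1; ring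
    have z7 : |b + 1 - (a + 2)| = |a - b + 1| := by rw [abs_sub_comm]; congr 1; ring
    have z8 : |b + 0 - (a + 2)| = |a - b + 2| := by rw [abs_sub_comm]; congr 1; ring
    rw [z0, z1, z2, z3, z4, z5, z6, z7, z8]
    ring

set_option maxHeartbeats 1000000 in
lemma upper {Ω : Type*} {m0 : MeasurableSpace Ω} (P : Measure Ω)
    [IsProbabilityMeasure P]
    (H β : ℝ) (hβ : 0 < β) (hβH : β < H) (hH : H < 1)
    (X : ℝ → Ω → ℝ)
    (hmeas : ∀ t, Measurable (X t))
    (hgauss : ∀ (n : ℕ) (c : Fin n → ℝ) (t : Fin n → ℝ),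
      ∃ v : NNReal, P.map (fun ω => ∑ i, c i * X (t i) ω) = gaussianReal 0 v)
    (hcov : ∀ s t : ℝ, ∫ ω, X s ω * X t ω ∂P =
      (1/2) * (|s| ^ (2*H) + |t| ^ (2*H) - |t - s| ^ (2*H))) :
    ∃ Q : ℝ, 0 < Q ∧ ∀ ε : ℝ, 0 < ε → Q ≤ ε ^ (-(1/(H - β))) →
      P.real {ω | ∀ s ∈ Set.Icc (0:ℝ) 1, ∀ t ∈ Set.Icc (0:ℝ) 1,
            s < t → |X t ω - X s ω| ≤ ε * (t - s) ^ β} ≤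
      Real.exp (-(1 / (2 * Q) * ε ^ (-(1/(H - β))))) := by
  have hκ : 0 < H - β := by linarith
  set κ := H - β with hκdef
  have hH0 : 0 < H := by linarith
  obtain ⟨C, hC, hgam⟩ := gam_bound (p := 2 * H) (by linarith)
  obtain ⟨B, hB, hquad⟩ := quad_form
  set g0 : ℝ := 4 - 2 ^ (2 * H) with hg0
  have hg0p : 0 < g0 := by
    have : (2:ℝ) ^ (2 * H) < 2 ^ (2:ℝ) := Real.rpow_lt_rpow_of_exponent_lt one_lt_two (by linarith)
    have h4 : (2:ℝ) ^ (2:ℝ) = 4 := by norm_num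
    rw [hg0]; linarith
  have hgam0 : gam (2 * H) 0 = g0 := by
    have h0 : (0:ℝ) ^ (2 * H) = 0 := Real.zero_rpow (by positivity)
    simp [gam, h0, hg0]
    ring
  obtain ⟨L, hL0⟩ : ∃ L : ℝ, max 4 (2 * B * C / g0) ≤ L := ⟨_, le_rfl⟩
  have hL4 : 4 ≤ L := (le_max_left _ _).trans hL0
  have hLB : B * (C / L ^ 2) ≤ g0 / 2 := by
    have h1 : 2 * B * C / g0 ≤ L := (le_max_right _ _).trans hL0
    rw [div_le_iff₀ hg0p] at h1
    rw [mul_div_assoc', div_le_iff₀ (by positivity)]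
    nlinarith [mul_pos hg0p (show 0 < L by linarith)]
  set R : ℝ := (4 * Real.exp 4 / g0) ^ (1 / (2 * κ)) with hR
  have hRp : 0 < R := by positivity
  have hR2 : R ^ (2 * κ) = 4 * Real.exp 4 / g0 := by
    rw [hR, ← Real.rpow_mul (by positivity)]
    have : 1 / (2 * κ) * (2 * κ) = 1 := by field_simp
    rw [this, Real.rpow_one]
  have hLp : 0 < L := by linarith
  refine ⟨L * R, by positivity, fun ε hε hQ => ?_⟩
  set u := ε ^ (-(1/κ)) with hu
  have hup : 0 < u := by positivity
  set δ : ℝ := R / u with hδ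
  have hδp : 0 < δ := by positivity
  set n : ℕ := ⌊u / (L * R)⌋₊ with hn
  have hn1 : (n : ℝ) ≤ u / (L * R) := Nat.floor_le (by positivity)
  have hx1 : 1 ≤ u / (L * R) := by rw [le_div_iff₀ (by positivity)]; linarith
  have hn2 : 1 / (2 * (L * R)) * u ≤ n := by
    have h1 : u / (L * R) < n + 1 := Nat.lt_floor_add_one _
    have h2 : (1:ℝ) ≤ n := by
      have : 1 ≤ n := Nat.le_floor (by simpa using hx1)
      exact_mod_cast this
    have : 1 / (2 * (L * R)) * u = (u / (L * R)) / 2 := by field_simp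
    rw [this]; linarith
  have hnδ : δ * (L * n) ≤ 1 := by
    rw [le_div_iff₀ (by positivity)] at hn1
    rw [hδ, div_mul_eq_mul_div, div_le_one hup]
    linarith
  set D : Fin n → Ω → ℝ := fun k ω => X (δ * (L * (k : ℕ) + 2)) ω
      - 2 * X (δ * (L * (k : ℕ) + 1)) ω + X (δ * (L * (k : ℕ))) ω with hD
  have hDm : ∀ k, Measurable (D k) := fun k =>
    ((hmeas _).sub ((hmeas _).const_mul 2)).add (hmeas _)
  set M : ℝ := 2 * (ε * δ ^ β) with hM
  have hMp : 0 < M := by positivity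
  have hch := cheb P D hDm (δ ^ (2 * H) * (g0 / 2)) (by positivity) (by
    intro c
    obtain ⟨v, hv1, hv2⟩ := second_var hmeas hgauss hcov δ L hδp n c
    refine ⟨v, hv1, ?_⟩
    rw [hv2, mul_assoc]
    gcongr
    refine hquad n (fun k l => gam (2 * H) (L * ((k : ℕ) - (l : ℕ)))) g0 (C / L ^ 2) (by positivity)
      (fun k => by simp [hgam0]) (fun k l hkl => ?_) hLB c
    have hz : (1:ℝ) ≤ |((k : ℕ) : ℝ) - ((l : ℕ) : ℝ)| := by
      have h1 : ((k : ℕ) : ℤ) - ((l : ℕ) : ℤ) ≠ 0 := by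
        intro h
        exact hkl (Fin.ext (by omega))
      have := Int.one_le_abs h1
      exact_mod_cast this
    refine (hgam _ ?_).trans (le_of_eq ?_)
    · rw [abs_mul, abs_of_pos hLp]
      nlinarith
    · rw [mul_pow, div_div]) M (1 / M ^ 2) (by positivity)
  have hsub : {ω | ∀ s ∈ Set.Icc (0:ℝ) 1, ∀ t ∈ Set.Icc (0:ℝ) 1,
            s < t → |X t ω - X s ω| ≤ ε * (t - s) ^ β} ⊆ {ω | ∀ i, |D i ω| ≤ M} := by
    intro ω hω k
    have hk : ((k : ℕ) : ℝ) + 1 ≤ n := by exact_mod_cast k.2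
    have hk0 : (0:ℝ) ≤ ((k : ℕ) : ℝ) := Nat.cast_nonneg _
    have t2 : δ * (L * (k : ℕ) + 2) ≤ 1 := by
      refine le_trans ?_ hnδ
      gcongr
      nlinarith
    have m0 : δ * (L * (k : ℕ)) ∈ Set.Icc (0:ℝ) 1 := ⟨by positivity, by nlinarith⟩
    have m1 : δ * (L * (k : ℕ) + 1) ∈ Set.Icc (0:ℝ) 1 := ⟨by positivity, by nlinarith⟩
    have m2 : δ * (L * (k : ℕ) + 2) ∈ Set.Icc (0:ℝ) 1 := ⟨by positivity, t2⟩
    have h1 := hω _ m0 _ m1 (by nlinarith)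
    have h2 := hω _ m1 _ m2 (by nlinarith)
    rw [show δ * (L * (k : ℕ) + 1) - δ * (L * (k : ℕ)) = δ by ring] at h1
    rw [show δ * (L * (k : ℕ) + 2) - δ * (L * (k : ℕ) + 1) = δ by ring] at h2
    simp only [hD, hM]
    rw [abs_le] at h1 h2 ⊢
    constructor <;> linarith [h1.1, h1.2, h2.1, h2.2]
  refine (measureReal_mono hsub).trans (hch.trans ?_)
  have key : Real.exp (1 / M ^ 2 * M ^ 2) / √(1 + 2 * (1 / M ^ 2 * (δ ^ (2 * H) * (g0 / 2)))) ≤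
      Real.exp (-1) := by
    have e1 : 1 / M ^ 2 * M ^ 2 = 1 := by field_simp
    have e2 : 2 * (1 / M ^ 2 * (δ ^ (2 * H) * (g0 / 2))) = Real.exp 4 := by
      have a1 : δ ^ (2 * H) = (δ ^ β) ^ 2 * δ ^ (2 * κ) := by
        rw [← Real.rpow_natCast, ← Real.rpow_mul hδp.le, ← Real.rpow_add hδp]
        congr 1; rw [hκdef]; push_cast; ring
      have a2 : δ ^ (2 * κ) = 4 * Real.exp 4 / g0 * ε ^ 2 := by
        rw [hδ, Real.div_rpow hRp.le hup.le, hR2, hu, ← Real.rpow_mul hε.le]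
        have : -(1 / κ) * (2 * κ) = -2 := by field_simp
        rw [this, Real.rpow_neg hε.le]
        norm_cast
        rw [div_inv_eq_mul]
      have hδβ : 0 < δ ^ β := by positivity
      rw [a1, a2, hM]
      field_simp
      norm_num
    rw [e1, e2, div_le_iff₀ (by positivity)]
    have : Real.exp 2 ≤ √(1 + Real.exp 4) := by
      apply Real.le_sqrt_of_sq_le
      rw [← Real.exp_nat_mul]
      norm_num
    calc Real.exp 1 = Real.exp (-1) * Real.exp 2 := by rw [← Real.exp_add]; norm_num
      _ ≤ _ := by gcongr
  calc _ ≤ Real.exp (-1) ^ n := pow_le_pow_left₀ (by positivity) key n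
    _ = Real.exp (-n) := by rw [← Real.exp_nat_mul]; congr 1; ring
    _ ≤ _ := by rw [Real.exp_le_exp]; linarith

lemma gauss_lt_one : (gaussianReal 0 1).real (Set.Icc (-1) 1) < 1 := by
  by_contra h
  push Not at h
  have h1 : (gaussianReal 0 1).real (Set.Icc (-1) 1)ᶜ = 0 := by
    rw [probReal_compl_eq_one_sub measurableSet_Icc]
    have := measureReal_nonneg (μ := gaussianReal 0 1) (s := (Set.Icc (-1:ℝ) 1)ᶜ)
    rw [probReal_compl_eq_one_sub measurableSet_Icc] at this
    linarith
  rw [measureReal_eq_zero_iff] at h1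
  have h2 := gaussianReal_absolutelyContinuous' 0 (one_ne_zero) h1
  have h3 : (volume : Measure ℝ) (Set.Ioo 1 2) ≤ volume (Set.Icc (-1:ℝ) 1)ᶜ := by
    refine measure_mono fun x hx hx' => ?_
    linarith [hx.1, hx'.2]
  rw [h2] at h3
  norm_num at h3

end FbmSB

theorem small_ball_holder_fbm
    {Ω : Type*} {m0 : MeasurableSpace Ω} (P : Measure Ω)
    [IsProbabilityMeasure P]
    (H β : ℝ) (hβ : 0 < β) (hβH : β < H) (hH : H < 1)
    (X : ℝ → Ω → ℝ)
    (hmeas : ∀ t, Measurable (X t))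
    (hcont : ∀ ω, Continuous fun t => X t ω)
    (hgauss : ∀ (n : ℕ) (c : Fin n → ℝ) (t : Fin n → ℝ),
      ∃ v : NNReal, P.map (fun ω => ∑ i, c i * X (t i) ω) = gaussianReal 0 v)
    (hcov : ∀ s t : ℝ, ∫ ω, X s ω * X t ω ∂P =
      (1/2) * (|s| ^ (2*H) + |t| ^ (2*H) - |t - s| ^ (2*H))) :
    ∃ K₁ K₂ : ℝ, 0 < K₁ ∧ K₁ ≤ K₂ ∧
      ∀ ε : ℝ, 0 < ε → ε < 1 →
        -K₂ * ε ^ (-(1/(H - β))) ≤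
          Real.log (P {ω | ∀ s ∈ Set.Icc (0:ℝ) 1, ∀ t ∈ Set.Icc (0:ℝ) 1,
            s < t → |X t ω - X s ω| ≤ ε * (t - s) ^ β}).toReal ∧
        Real.log (P {ω | ∀ s ∈ Set.Icc (0:ℝ) 1, ∀ t ∈ Set.Icc (0:ℝ) 1,
            s < t → |X t ω - X s ω| ≤ ε * (t - s) ^ β}).toReal ≤
          -K₁ * ε ^ (-(1/(H - β))) := by
  obtain ⟨K, hK, hlow⟩ := FbmSB.lower P H β hβ hβH hH X hmeas hcont hgauss hcov
  obtain ⟨Q, hQ, hup⟩ := FbmSB.upper P H β hβ hβH hH X hmeas hgauss hcov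
  set p1 : ℝ := (gaussianReal 0 1).real (Set.Icc (-1) 1) with hp1
  have hp1lt : p1 < 1 := FbmSB.gauss_lt_one
  have hcoarse : ∀ ε : ℝ, 0 < ε → ε < 1 → P.real {ω | ∀ s ∈ Set.Icc (0:ℝ) 1, ∀ t ∈ Set.Icc (0:ℝ) 1,
            s < t → |X t ω - X s ω| ≤ ε * (t - s) ^ β} ≤ p1 := by
    intro ε hε hε1
    have hlaw := FbmSB.incr_law hmeas hgauss hcov (by linarith) 0 1
    have e : (|(1:ℝ) - 0| ^ (2 * H)).toNNReal = 1 := by simp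
    rw [e] at hlaw
    rw [hp1, ← hlaw, map_measureReal_apply (f := fun ω => X 1 ω - X 0 ω)
      ((hmeas _).sub (hmeas _)) measurableSet_Icc]
    refine measureReal_mono fun ω hω => ?_
    have := hω 0 ⟨le_rfl, zero_le_one⟩ 1 ⟨zero_le_one, le_rfl⟩ zero_lt_one
    simp only [sub_zero, Real.one_rpow, mul_one] at this
    have := abs_le.1 (this.trans hε1.le)
    exact ⟨this.1, this.2⟩
  have hp1pos : 0 < p1 :=
    lt_of_lt_of_le (Real.exp_pos _) ((hlow (1/2) (by norm_num) (by norm_num)).trans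
      (hcoarse (1/2) (by norm_num) (by norm_num)))
  have hlogp : Real.log p1 < 0 := Real.log_neg hp1pos hp1lt
  set K₁ := min (1 / (2 * Q)) (-Real.log p1 / Q) with hK1
  have hK1p : 0 < K₁ := lt_min (by positivity) (div_pos (by linarith) hQ)
  refine ⟨K₁, max K K₁, hK1p, le_max_right _ _, fun ε hε hε1 => ?_⟩
  have hl := hlow ε hε hε1
  have hc := hcoarse ε hε hε1
  have hu := hup ε hε
  change _ ≤ Real.log (P.real _) ∧ Real.log (P.real _) ≤ _
  set q := P.real {ω | ∀ s ∈ Set.Icc (0:ℝ) 1, ∀ t ∈ Set.Icc (0:ℝ) 1,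
            s < t → |X t ω - X s ω| ≤ ε * (t - s) ^ β} with hq
  set u := ε ^ (-(1/(H - β))) with hudef
  have hu0 : 0 < u := by positivity
  have hq0 : 0 < q := lt_of_lt_of_le (Real.exp_pos _) hl
  constructor
  · rw [Real.le_log_iff_exp_le hq0]
    refine le_trans ?_ hl
    rw [Real.exp_le_exp]
    have : K * u ≤ max K K₁ * u := by gcongr; exact le_max_left _ _
    linarith
  · by_cases hQu : Q ≤ u
    · rw [Real.log_le_iff_le_exp hq0]
      refine (hu hQu).trans ?_
      rw [Real.exp_le_exp]
      have : K₁ * u ≤ 1 / (2 * Q) * u := by gcongr; exact min_le_left _ _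
      linarith
    · push Not at hQu
      have h1 : Real.log q ≤ Real.log p1 := Real.log_le_log hq0 hc
      have h2 : K₁ * u ≤ -Real.log p1 := by
        calc K₁ * u ≤ -Real.log p1 / Q * Q := by
              apply mul_le_mul (min_le_right _ _) hQu.le hu0.le
              exact (div_pos (by linarith) hQ).le
          _ = _ := by field_simp
      linarith
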